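/- Let p be an odd prime and n an even positive integer. Let f : F_{p^n} → F_p be a weakly regular bent function whose Walsh coefficients satisfy W_f(b) = u (p*)^{n/2} ω_p^{f*(b)} for all b ∈ F_{p^n}, where u ∈ {1,−1}, p* = (−1)^{(p−1)/2} p, and f* : F_{p^n} → F_p. Suppose there exists a positive integer k with gcd(k−1, p−1) = 1 such that f(tx) = t^k f(x) for all t ∈ F_p and all x ∈ F_{p^n}. Then each of the three sets D_0∖{0}, D_R, and D_N is a partial difference set in (F_{p^n},+); i.e., for each of these sets S there exist λ, μ such that S is a (p^n, |S|, λ, μ) partial difference set. -/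

import Mathlib

open Finset

noncomputable section
open scoped Classical

noncomputable instance (p n : ℕ) [Fact p.Prime] : Fintype (GaloisField p n) :=
  Fintype.ofFinite _

/-- `ω_p^a` for `a ∈ F_p`, where `ω_p = exp(2πi/p)`. -/
def ez (p : ℕ) (a : ZMod p) : ℂ :=
  Complex.exp (2 * Real.pi * Complex.I * (a.val : ℂ) / p)

/-- The Walsh coefficient `W_f(b) = ∑_{x∈F_{p^n}} ω_p^{f(x)+Tr(bx)}`. -/
def walsh (p n : ℕ) [Fact p.Prime] (f : GaloisField p n → ZMod p) (b : GaloisField p n) : ℂ :=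
  ∑ x : GaloisField p n,
    ez p (f x + Algebra.trace (ZMod p) (GaloisField p n) (b * x))

/-- The quadratic Gauss sum `G = ∑_{t∈F_p} ω_p^{t²}`. -/
def gaussSum' (p : ℕ) [NeZero p] : ℂ := ∑ t : ZMod p, ez p (t ^ 2)

/-- `D` is a `(v,k,λ,μ)` partial difference set in the finite abelian group `G`. -/
def IsPDS {G : Type*} [AddCommGroup G] [Fintype G] (D : Finset G) (v k lam mu : ℤ) : Prop :=
  (Fintype.card G : ℤ) = v ∧ (D.card : ℤ) = k ∧
    ∀ g : G, g ≠ 0 →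
      ((((D ×ˢ D).filter fun xy => xy.1 - xy.2 = g).card : ℤ) = if g ∈ D then lam else mu)

/-- A symmetric subset of a finite field all of whose nontrivial character sums lie in
`{α, β}` is a partial difference set. -/
theorem exists_isPDS_of_charSum {F : Type*} [Field F] [Fintype F] {ψ : AddChar F ℂ}
    (hψ : ψ.IsPrimitive) (D : Finset F) (hneg : ∀ x ∈ D, -x ∈ D) (α β : ℂ)
    (h : ∀ b ≠ 0, ∑ x ∈ D, ψ (b * x) = α ∨ ∑ x ∈ D, ψ (b * x) = β) :
    ∃ lam mu : ℤ, IsPDS D (Fintype.card F) D.card lam mu := by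
  set S : F → ℂ := fun b => ∑ x ∈ D, ψ (b * x) with hS
  have hSneg (b : F) : S b = ∑ y ∈ D, ψ (-(b * y)) := by
    refine Finset.sum_nbij' (fun x => -x) (fun x => -x) hneg hneg ?_ ?_ ?_ <;> simp
  have hlin (g : F) : ∑ b, S b * ψ (-(b * g)) = if g ∈ D then (Fintype.card F : ℂ) else 0 := by
    simp_rw [hS, Finset.sum_mul, ← AddChar.map_add_eq_mul]
    rw [Finset.sum_comm]
    have (x : F) : ∑ b, ψ (b * x + -(b * g)) = if x = g then (Fintype.card F : ℂ) else 0 := by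
      have := AddChar.sum_mulShift (x - g) hψ
      simpa only [mul_sub, sub_eq_zero, ← sub_eq_add_neg, Nat.cast_ite, Nat.cast_zero] using this
    simp [this]
  have hsq (g : F) : ∑ b, S b * S b * ψ (-(b * g)) =
      Fintype.card F * (((D ×ˢ D).filter fun xy => xy.1 - xy.2 = g).card : ℂ) := by
    have hb (b : F) : S b * S b * ψ (-(b * g)) =
        ∑ xy ∈ D ×ˢ D, ψ (b * (xy.1 - xy.2 - g)) := by
      conv_lhs => rw [hSneg b]
      conv_lhs => enter [1, 1]; rw [← hSneg b]
      rw [hS, Finset.sum_mul_sum, ← Finset.sum_product', Finset.sum_mul]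
      refine Finset.sum_congr rfl fun xy _ => ?_
      rw [← AddChar.map_add_eq_mul, ← AddChar.map_add_eq_mul]
      congr 1; ring
    simp_rw [hb]
    rw [Finset.sum_comm]
    simp_rw [AddChar.sum_mulShift _ hψ, sub_eq_zero]
    simp [Finset.sum_ite, mul_comm]
  set C : ℂ := S 0 * S 0 - (α + β) * S 0 + α * β with hC
  have hquad (b : F) : S b * S b = (α + β) * S b - α * β + if b = 0 then C else 0 := by
    by_cases hb : b = 0
    · subst hb; simp [hC]
    · rcases h b hb with hb' | hb' <;> simp only [hS, hb', hb, if_false] <;> ring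
  have hcount (g : F) (hg : g ≠ 0) :
      Fintype.card F * (((D ×ˢ D).filter fun xy => xy.1 - xy.2 = g).card : ℂ) =
        (α + β) * (if g ∈ D then (Fintype.card F : ℂ) else 0) + C := by
    have h0 : ∑ b, ψ (-(b * g)) = 0 := by
      have := AddChar.sum_mulShift (-g) hψ
      simpa [hg] using this
    have hb (b : F) : S b * S b * ψ (-(b * g)) = (α + β) * (S b * ψ (-(b * g))) -
        α * β * ψ (-(b * g)) + if b = 0 then C else 0 := by
      rw [hquad]
      split_ifs with hb
      · simp [hb]
      · ring
    simp_rw [← hsq, ← hlin, hb, Finset.sum_add_distrib, Finset.sum_sub_distrib, ← Finset.mul_sum,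
      h0, mul_zero, sub_zero, Finset.sum_ite_eq' Finset.univ (0 : F), Finset.mem_univ, if_true]
  have hconst (g g' : F) (hg : g ≠ 0) (hg' : g' ≠ 0) (hmem : g ∈ D ↔ g' ∈ D) :
      (((D ×ˢ D).filter fun xy => xy.1 - xy.2 = g).card : ℤ) =
        ((D ×ˢ D).filter fun xy => xy.1 - xy.2 = g').card := by
    have hcard : (Fintype.card F : ℂ) ≠ 0 := Nat.cast_ne_zero.mpr Fintype.card_ne_zero
    have := (hcount g hg).trans ((by simp only [hmem]) : _ = _) |>.trans (hcount g' hg').symm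
    exact_mod_cast mul_left_cancel₀ hcard this
  have hval (P : Prop) : ∃ c : ℤ, ∀ g : F, g ≠ 0 → (g ∈ D ↔ P) →
      (((D ×ˢ D).filter fun xy => xy.1 - xy.2 = g).card : ℤ) = c := by
    by_cases hex : ∃ g : F, g ≠ 0 ∧ (g ∈ D ↔ P)
    · obtain ⟨g₀, hg₀, hm⟩ := hex
      exact ⟨_, fun g hg hgm => hconst g g₀ hg hg₀ (hgm.trans hm.symm)⟩
    · exact ⟨0, fun g hg hgm => (hex ⟨g, hg, hgm⟩).elim⟩
  obtain ⟨lam, hlam⟩ := hval True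
  obtain ⟨mu, hmu⟩ := hval False
  refine ⟨lam, mu, rfl, rfl, fun g hg => ?_⟩
  split_ifs with hgD
  · exact hlam g hg (by simpa)
  · exact hmu g hg (by simpa)

theorem ez_eq_stdAddChar (p : ℕ) [Fact p.Prime] (a : ZMod p) :
    ez p a = ZMod.stdAddChar a := by
  rw [ez, ZMod.stdAddChar_apply, ZMod.toCircle_apply]

theorem isPrimitiveRoot_stdAddChar {p : ℕ} [Fact p.Prime] {c : ZMod p} (hc : c ≠ 0) :
    IsPrimitiveRoot (ZMod.stdAddChar c) p := by
  have hp : (ZMod.stdAddChar c) ^ p = 1 := by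
    rw [← AddChar.map_nsmul_eq_pow]; simp
  have h1 : ZMod.stdAddChar c ≠ 1 := fun h =>
    hc (ZMod.injective_stdAddChar (h.trans (AddChar.map_zero_eq_one _).symm))
  exact IsPrimitiveRoot.iff_orderOf.mpr (orderOf_eq_prime hp h1)

/-- The Galois action `ω ↦ ω ^ c` applied to a relation among `p`-th roots of unity. -/
theorem sum_stdAddChar_mul {p : ℕ} [Fact p.Prime] {ι : Type*} (s : Finset ι) (a : ι → ZMod p)
    (M : ℤ) (m : ZMod p) (h : ∑ i ∈ s, ZMod.stdAddChar (a i) = M * ZMod.stdAddChar m)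
    {c : ZMod p} (hc : c ≠ 0) :
    ∑ i ∈ s, ZMod.stdAddChar (c * a i) = M * ZMod.stdAddChar (c * m) := by
  have hmul (c a : ZMod p) : (ZMod.stdAddChar (c * a) : ℂ) = ZMod.stdAddChar c ^ a.val := by
    rw [← AddChar.map_nsmul_eq_pow, nsmul_eq_mul, ZMod.natCast_zmod_val, mul_comm]
  let Q : Polynomial ℤ := ∑ i ∈ s, Polynomial.X ^ (a i).val - Polynomial.C M * Polynomial.X ^ m.val
  have hQ (c : ZMod p) : Polynomial.aeval (ZMod.stdAddChar c : ℂ) Q =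
      ∑ i ∈ s, ZMod.stdAddChar (c * a i) - M * ZMod.stdAddChar (c * m) := by
    simp [Q, hmul]
  have hpos := (Fact.out : p.Prime).pos
  have h1 := isPrimitiveRoot_stdAddChar (p := p) one_ne_zero
  have hdvd : minpoly ℤ (ZMod.stdAddChar (1 : ZMod p) : ℂ) ∣ Q :=
    minpoly.isIntegrallyClosed_dvd (h1.isIntegral hpos) (by rw [hQ]; simp [h])
  rw [← Polynomial.cyclotomic_eq_minpoly h1 hpos,
    Polynomial.cyclotomic_eq_minpoly (isPrimitiveRoot_stdAddChar hc) hpos] at hdvd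
  rw [← sub_eq_zero, ← hQ]
  exact Polynomial.aeval_eq_zero_of_dvd_aeval_eq_zero hdvd (minpoly.aeval _ _)

/-- The canonical additive character `x ↦ ω ^ Tr x` of a finite field of characteristic `p`. -/
def traceChar (p n : ℕ) [Fact p.Prime] : AddChar (GaloisField p n) ℂ :=
  (ZMod.stdAddChar (N := p)).compAddMonoidHom
    (Algebra.trace (ZMod p) (GaloisField p n)).toAddMonoidHom

theorem traceChar_apply (p n : ℕ) [Fact p.Prime] (x : GaloisField p n) :
    traceChar p n x = ZMod.stdAddChar (Algebra.trace (ZMod p) (GaloisField p n) x) := rfl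

theorem isPrimitive_traceChar (p n : ℕ) [Fact p.Prime] : (traceChar p n).IsPrimitive := by
  apply AddChar.IsPrimitive.of_ne_one
  intro h
  obtain ⟨x, hx⟩ := Algebra.trace_surjective (ZMod p) (GaloisField p n) 1
  have h1 : traceChar p n x = 1 := by rw [h]; rfl
  rw [traceChar_apply, hx] at h1
  exact one_ne_zero (ZMod.injective_stdAddChar (h1.trans (AddChar.map_zero_eq_one _).symm))

theorem pow_injective_of_coprime {p m : ℕ} [Fact p.Prime] (hm : m ≠ 0)
    (h : Nat.gcd m (p - 1) = 1) : Function.Injective fun t : ZMod p => t ^ m := by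
  intro a b hab
  simp only at hab
  by_cases hb : b = 0
  · subst hb
    rw [zero_pow hm] at hab
    exact eq_zero_of_pow_eq_zero hab
  have ha : a ≠ 0 := by
    rintro rfl
    rw [zero_pow hm] at hab
    exact hb (eq_zero_of_pow_eq_zero hab.symm)
  have h1 : (a / b) ^ m = 1 := by rw [div_pow, hab, div_self (pow_ne_zero _ hb)]
  have h2 := ZMod.pow_card_sub_one_eq_one (div_ne_zero ha hb)
  have h3 : (a / b) ^ Nat.gcd m (p - 1) = 1 := pow_gcd_eq_one.mpr ⟨h1, h2⟩
  rw [h, pow_one] at h3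
  exact (div_eq_one_iff_eq hb).mp h3

section Bent

variable {p n : ℕ} [Fact p.Prime] {f fstar : GaloisField p n → ZMod p} {M : ℤ} {k : ℕ}

/-- The Walsh transform of `c ^ (1 - k) • f`. -/
theorem sum_stdAddChar_inv_pow_mul
    (hW : ∀ b, walsh p n f b = M * ez p (fstar b)) (hk : 0 < k)
    (hhom : ∀ (t : ZMod p) (x : GaloisField p n),
      f (algebraMap (ZMod p) (GaloisField p n) t * x) = t ^ k * f x)
    (b : GaloisField p n) {c : ZMod p} (hc : c ≠ 0) :
    ∑ x, ZMod.stdAddChar (c⁻¹ ^ (k - 1) * f x) * traceChar p n (b * x) =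
      M * ZMod.stdAddChar (c * fstar b) := by
  have hWb := hW b
  simp only [walsh, ez_eq_stdAddChar] at hWb
  rw [← sum_stdAddChar_mul _ _ _ _ hWb hc]
  have hc' : algebraMap (ZMod p) (GaloisField p n) c ≠ 0 := by simpa using hc
  symm
  refine Fintype.sum_bijective _ (mulLeft_bijective₀ _ hc') _ _ fun x => ?_
  rw [traceChar_apply, ← AddChar.map_add_eq_mul, hhom, mul_left_comm b, ← Algebra.smul_def,
    map_smul, smul_eq_mul, mul_add, ← mul_assoc]
  have : c⁻¹ ^ (k - 1) * c ^ k = c := by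
    obtain ⟨j, rfl⟩ : ∃ j, k = j + 1 := ⟨k - 1, by omega⟩
    rw [Nat.add_sub_cancel, pow_succ, ← mul_assoc, ← mul_pow, inv_mul_cancel₀ hc, one_pow, one_mul]
  rw [this]

/-- The character sums over the preimage of a union of square classes. -/
theorem charSum_preimage
    (hW : ∀ b, walsh p n f b = M * ez p (fstar b)) (hk : Even k) (hk2 : 2 ≤ k)
    (hkgcd : Nat.gcd (k - 1) (p - 1) = 1)
    (hhom : ∀ (t : ZMod p) (x : GaloisField p n),
      f (algebraMap (ZMod p) (GaloisField p n) t * x) = t ^ k * f x)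
    (H : Finset (ZMod p)) (hH : ∀ s ≠ 0, ∀ a ∈ H, s ^ 2 * a ∈ H)
    {b : GaloisField p n} (hb : b ≠ 0) :
    p * ∑ x with f x ∈ H, traceChar p n (b * x) =
      M * ((if fstar b ∈ H then (p : ℂ) else 0) - H.card) := by
  set e : ZMod p → ZMod p := fun t => t⁻¹ ^ (k - 1) with he
  have he0 : e 0 = 0 := by simp [he, show k - 1 ≠ 0 by omega]
  have hebij : Function.Bijective e :=
    Finite.injective_iff_bijective.mp
      ((pow_injective_of_coprime (by omega) hkgcd).comp inv_injective)
  set T : ZMod p → ℂ := fun t => ∑ x, ZMod.stdAddChar (t * f x) * traceChar p n (b * x) with hT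
  set h : ZMod p → ℂ := fun t => ∑ i ∈ H, ZMod.stdAddChar (-(t * i)) with hh
  have horth (a : ZMod p) : ∑ t, h t * ZMod.stdAddChar (t * a) = if a ∈ H then (p : ℂ) else 0 := by
    simp_rw [hh, Finset.sum_mul, ← AddChar.map_add_eq_mul]
    rw [Finset.sum_comm]
    have (i : ZMod p) : ∑ t, (ZMod.stdAddChar (-(t * i) + t * a) : ℂ) =
        if i = a then (p : ℂ) else 0 := by
      have := AddChar.sum_mulShift (a - i) (ZMod.isPrimitive_stdAddChar p)
      rw [ZMod.card, Nat.cast_ite, Nat.cast_zero] at this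
      simp only [mul_sub, sub_eq_zero, eq_comm (a := a)] at this
      simpa only [sub_eq_neg_add] using this
    simp [this]
  have hT0 : T 0 = 0 := by
    have := AddChar.sum_mulShift b (isPrimitive_traceChar p n)
    simpa [hT, hb, mul_comm b] using this
  have hTe (c : ZMod p) :
      T (e c) = M * ZMod.stdAddChar (c * fstar b) - if c = 0 then (M : ℂ) else 0 := by
    by_cases hc : c = 0
    · subst hc; simp [he0, hT0]
    · rw [if_neg hc, sub_zero, ← sum_stdAddChar_inv_pow_mul hW (by omega) hhom b hc]
  have hhe (c : ZMod p) : h (e c) = h c := by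
    by_cases hc : c = 0
    · rw [hc, he0]
    obtain ⟨j, hj⟩ := hk
    have hs : (c ^ j) ≠ 0 := pow_ne_zero _ hc
    have hec : e c * (c ^ j) ^ 2 = c := by
      rw [← pow_mul, show j * 2 = (k - 1) + 1 by omega, pow_succ, ← mul_assoc, he, ← mul_pow,
        inv_mul_cancel₀ hc, one_pow, one_mul]
    symm
    refine Finset.sum_nbij' (fun i => (c ^ j) ^ 2 * i) (fun i => ((c ^ j)⁻¹) ^ 2 * i)
      (hH _ hs) (hH _ (inv_ne_zero hs)) ?_ ?_ ?_
    · intro i _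
      rw [← mul_assoc, ← mul_pow, inv_mul_cancel₀ hs, one_pow, one_mul]
    · intro i _
      rw [← mul_assoc, ← mul_pow, mul_inv_cancel₀ hs, one_pow, one_mul]
    · intro i _
      rw [← mul_assoc, hec]
  calc p * ∑ x with f x ∈ H, traceChar p n (b * x)
      = ∑ x, (∑ t, h t * ZMod.stdAddChar (t * f x)) * traceChar p n (b * x) := by
        simp_rw [horth, Finset.mul_sum, Finset.sum_filter, ite_mul, zero_mul]
    _ = ∑ t, h t * T t := by
        simp_rw [hT, Finset.sum_mul, Finset.mul_sum, mul_assoc]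
        exact Finset.sum_comm
    _ = ∑ c, h (e c) * T (e c) := (hebij.sum_comp fun t => h t * T t).symm
    _ = M * ∑ c, h c * ZMod.stdAddChar (c * fstar b) - h 0 * M := by
        simp_rw [hhe, hTe, mul_sub, Finset.sum_sub_distrib, Finset.mul_sum, mul_left_comm (M : ℂ)]
        simp
    _ = _ := by
        rw [horth]
        simp only [hh, zero_mul, neg_zero, AddChar.map_zero_eq_one, Finset.sum_const, nsmul_one]
        ring

end Bent

/-- **Theorem 3.5.**  Let `p` be an odd prime, `n` even, and `f : F_{p^n} → F_p` weakly regular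
bent with `W_f(b) = u (p*)^{n/2} ω_p^{f*(b)}` (`p* = (−1)^{(p−1)/2} p`), such that
`f(tx) = t^k f(x)` with `gcd(k−1,p−1) = 1`.  Then `D_0∖{0}`, `D_R`, and `D_N` are partial
difference sets in `(F_{p^n},+)`. -/
theorem bent_function_PDS
    (p : ℕ) [Fact p.Prime] (hp2 : p ≠ 2) (n : ℕ) (hn : 0 < n) (hneven : Even n)
    (f fstar : GaloisField p n → ZMod p) (u : ℤ) (hu : u = 1 ∨ u = -1)
    (hW : ∀ b : GaloisField p n,
      walsh p n f b
        = (u : ℂ) * ((((-1 : ℤ) ^ ((p - 1) / 2) * p : ℤ) : ℂ)) ^ (n / 2) * ez p (fstar b))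
    (k : ℕ) (hk : 0 < k) (hkgcd : Nat.gcd (k - 1) (p - 1) = 1)
    (hhom : ∀ (t : ZMod p) (x : GaloisField p n),
      f (algebraMap (ZMod p) (GaloisField p n) t * x) = t ^ k * f x) :
    (∃ lam mu : ℤ,
      IsPDS ((Finset.univ.filter fun x => f x = 0).erase 0) ((p : ℤ) ^ n)
        (((Finset.univ.filter fun x => f x = 0).erase 0).card : ℤ) lam mu) ∧
    (∃ lam mu : ℤ,
      IsPDS (Finset.univ.filter fun x => f x ≠ 0 ∧ IsSquare (f x)) ((p : ℤ) ^ n)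
        ((Finset.univ.filter fun x => f x ≠ 0 ∧ IsSquare (f x)).card : ℤ) lam mu) ∧
    (∃ lam mu : ℤ,
      IsPDS (Finset.univ.filter fun x => ¬IsSquare (f x)) ((p : ℤ) ^ n)
        ((Finset.univ.filter fun x => ¬IsSquare (f x)).card : ℤ) lam mu) := by
  have hp : p.Prime := Fact.out
  have hpodd : p % 2 = 1 := hp.eq_two_or_odd.resolve_left hp2
  have hp3 : 3 ≤ p := by have := hp.two_le; omega
  have hk2 : 2 ≤ k := by
    by_contra hlt
    obtain rfl : k = 1 := by omega
    simp at hkgcd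
    omega
  have hkeven : Even k := by
    by_contra hodd
    rw [Nat.not_even_iff] at hodd
    have : 2 ∣ Nat.gcd (k - 1) (p - 1) := Nat.dvd_gcd (by omega) (by omega)
    omega
  have hf0 : f 0 = 0 := by simpa [show k ≠ 0 by omega] using hhom 0 0
  have hfneg (x : GaloisField p n) : f (-x) = f x := by
    simpa [hkeven.neg_one_pow] using hhom (-1) x
  have hcard : ((Fintype.card (GaloisField p n) : ℕ) : ℤ) = (p : ℤ) ^ n := by
    rw [← Nat.card_eq_fintype_card, GaloisField.card p n hn.ne']
    push_cast; rfl
  have hp0 : (p : ℂ) ≠ 0 := Nat.cast_ne_zero.mpr hp.ne_zero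
  set M : ℤ := u * ((-1) ^ ((p - 1) / 2) * p) ^ (n / 2) with hM
  have hW' (b : GaloisField p n) : walsh p n f b = M * ez p (fstar b) := by
    rw [hW, hM]; push_cast; rfl
  have hsum (H : Finset (ZMod p)) (hH : ∀ s ≠ 0, ∀ a ∈ H, s ^ 2 * a ∈ H)
      (b : GaloisField p n) (hb : b ≠ 0) :
      ∑ x with f x ∈ H, traceChar p n (b * x) = M * (p - H.card) / p ∨
        ∑ x with f x ∈ H, traceChar p n (b * x) = M * (0 - H.card) / p := by
    have := charSum_preimage hW' hkeven hk2 hkgcd hhom H hH hb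
    split_ifs at this
    · exact Or.inl (by rw [← this, mul_div_cancel_left₀ _ hp0])
    · exact Or.inr (by rw [← this, mul_div_cancel_left₀ _ hp0])
  have hsquare {s a : ZMod p} (hs : s ≠ 0) : IsSquare (s ^ 2 * a) ↔ IsSquare a := by
    refine ⟨fun h => ?_, fun h => (IsSquare.sq s).mul h⟩
    have := (IsSquare.sq s⁻¹).mul h
    rwa [← mul_assoc, ← mul_pow, inv_mul_cancel₀ hs, one_pow, one_mul] at this
  have hpre (H : Finset (ZMod p)) (hH : ∀ s ≠ 0, ∀ a ∈ H, s ^ 2 * a ∈ H) :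
      ∃ lam mu : ℤ, IsPDS (Finset.univ.filter fun x => f x ∈ H)
        (Fintype.card (GaloisField p n)) (Finset.univ.filter fun x => f x ∈ H).card lam mu :=
    exists_isPDS_of_charSum (isPrimitive_traceChar p n) _ (by simp [hfneg]) _ _ (hsum H hH)
  rw [← hcard]
  refine ⟨?_, ?_, ?_⟩
  · refine exists_isPDS_of_charSum (isPrimitive_traceChar p n) _ (by simp [hfneg])
      (M * (p - 1) / p - 1) (M * (0 - 1) / p - 1) fun b hb => ?_
    have := hsum {0} (by simp) b hb
    simp only [Finset.mem_singleton, Finset.card_singleton, Nat.cast_one] at this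
    rw [Finset.sum_erase_eq_sub (by simp [hf0]), mul_zero, AddChar.map_zero_eq_one]
    exact this.imp (congrArg (· - 1)) (congrArg (· - 1))
  · simpa using hpre {a | a ≠ 0 ∧ IsSquare a} (by simp +contextual [hsquare])
  · simpa using hpre {a | ¬IsSquare a} (by simp +contextual [hsquare])
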